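/- arXiv:2206.05381 — 2 statements merged into one kernel-verified Lean document; each statement's English description precedes it below -/
import Mathlib

section
/- Let H be a real Hilbert space, T : H → H a nonexpansive map, u* ∈ H a fixed point of T, and let (u_k) be the averaged iteration of T starting from any u_0 ∈ H. Then for every k ≥ 0, ‖u_{k+1} − u*‖² ≤ ‖u_k − u*‖² − (1/4)‖u_k − T(u_k)‖². (This is the key descent inequality in the proof of Theorem 3.3.) -/
theorem averaged_iteration_descent {H : Type*} [NormedAddCommGroup H]
    [InnerProductSpace ℝ H] [CompleteSpace H]
    (T : H → H) (hT : ∀ x y : H, ‖T x - T y‖ ≤ ‖x - y‖)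
    (ustar : H) (hfix : T ustar = ustar)
    (u : ℕ → H) (hrec : ∀ k, u (k + 1) = (1 / 2 : ℝ) • u k + (1 / 2 : ℝ) • T (u k)) :
    ∀ k : ℕ, ‖u (k + 1) - ustar‖ ^ 2 ≤
      ‖u k - ustar‖ ^ 2 - (1 / 4) * ‖u k - T (u k)‖ ^ 2 := by
  intro k
  have hb : ‖T (u k) - ustar‖ ≤ ‖u k - ustar‖ := by
    simpa only [hfix] using hT (u k) ustar
  have hmid : u (k + 1) - ustar = (1 / 2 : ℝ) • ((u k - ustar) + (T (u k) - ustar)) := by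
    rw [hrec]
    module
  have hpar := parallelogram_law_with_norm ℝ (u k - ustar) (T (u k) - ustar)
  rw [sub_sub_sub_cancel_right] at hpar
  have hsq := pow_le_pow_left₀ (norm_nonneg _) hb 2
  rw [hmid, norm_smul, mul_pow, Real.norm_of_nonneg (by norm_num)]
  linarith
end

section
/- Let H be a real Hilbert space, T : H → H a nonexpansive map, u* ∈ H a fixed point of T, and let (u_k) be the averaged iteration of T starting from any u_0 ∈ H. Then for every N ≥ 0, ∑_{k=0}^{N} (1/4)‖u_k − T(u_k)‖² ≤ ‖u_0 − u*‖², and consequently ‖u_k − T(u_k)‖ → 0 as k → ∞. (This is the asymptotic regularity established in the proof of Theorem 3.3.) -/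
open Filter

/-- The norm of the midpoint of two vectors, by the parallelogram law. -/
lemma norm_sq_half_smul_add_half_smul {H : Type*} [NormedAddCommGroup H]
    [InnerProductSpace ℝ H] (x y : H) :
    ‖(1 / 2 : ℝ) • x + (1 / 2 : ℝ) • y‖ ^ 2 =
      1 / 2 * ‖x‖ ^ 2 + 1 / 2 * ‖y‖ ^ 2 - 1 / 4 * ‖x - y‖ ^ 2 := by
  rw [← smul_add, norm_smul, mul_pow, norm_add_sq_real, norm_sub_sq_real]
  norm_num
  ring

/-- Averaging a nonexpansive map decreases the squared distance to a fixed point by at least a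
quarter of the squared residual. -/
lemma norm_sq_averaged_sub_fixed_le {H : Type*} [NormedAddCommGroup H]
    [InnerProductSpace ℝ H] {T : H → H} (hT : ∀ x y : H, ‖T x - T y‖ ≤ ‖x - y‖)
    {p : H} (hp : T p = p) (x : H) :
    ‖(1 / 2 : ℝ) • x + (1 / 2 : ℝ) • T x - p‖ ^ 2 ≤
      ‖x - p‖ ^ 2 - 1 / 4 * ‖x - T x‖ ^ 2 := by
  have hmid : (1 / 2 : ℝ) • x + (1 / 2 : ℝ) • T x - p =
      (1 / 2 : ℝ) • (x - p) + (1 / 2 : ℝ) • (T x - p) := by module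
  have hdist : ‖T x - p‖ ≤ ‖x - p‖ := by simpa only [hp] using hT x p
  have hsq : ‖T x - p‖ ^ 2 ≤ ‖x - p‖ ^ 2 := by gcongr
  rw [hmid, norm_sq_half_smul_add_half_smul, sub_sub_sub_cancel_right]
  linarith

theorem averaged_iteration_asymptotic_regularity {H : Type*} [NormedAddCommGroup H]
    [InnerProductSpace ℝ H] [CompleteSpace H]
    (T : H → H) (hT : ∀ x y : H, ‖T x - T y‖ ≤ ‖x - y‖)
    (ustar : H) (hfix : T ustar = ustar)
    (u : ℕ → H) (hrec : ∀ k, u (k + 1) = (1 / 2 : ℝ) • u k + (1 / 2 : ℝ) • T (u k)) :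
    (∀ N : ℕ, ∑ k ∈ Finset.range (N + 1), (1 / 4 : ℝ) * ‖u k - T (u k)‖ ^ 2 ≤
        ‖u 0 - ustar‖ ^ 2) ∧
      Tendsto (fun k => ‖u k - T (u k)‖) atTop (nhds 0) := by
  have hstep (k : ℕ) :
      (1 / 4 : ℝ) * ‖u k - T (u k)‖ ^ 2 ≤ ‖u k - ustar‖ ^ 2 - ‖u (k + 1) - ustar‖ ^ 2 := by
    have h := norm_sq_averaged_sub_fixed_le hT hfix (u k)
    rw [← hrec] at h
    linarith
  have hsum (n : ℕ) :
      ∑ k ∈ Finset.range n, (1 / 4 : ℝ) * ‖u k - T (u k)‖ ^ 2 ≤ ‖u 0 - ustar‖ ^ 2 := by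
    refine (Finset.sum_le_sum fun k _ => hstep k).trans ?_
    rw [Finset.sum_range_sub' (fun k => ‖u k - ustar‖ ^ 2)]
    exact sub_le_self _ (sq_nonneg _)
  refine ⟨fun N => hsum (N + 1), ?_⟩
  have hlim := (summable_of_sum_range_le (fun k => by positivity) hsum).tendsto_atTop_zero
  simpa [← mul_assoc, Real.sqrt_sq] using (hlim.const_mul 4).sqrt
end
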